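/- Let H be a discrete ω-dimensional poc-set, let Σ be an almost-equality class of H°, and suppose a ∈ H is a proper element with Σ ⊆ S_a (every ultrafilter in Σ contains a). Then there exists a proper element b ∈ H with b < a and Σ ⊆ S_b. -/

import Mathlib

universe u

/-- A poc-set: a partially ordered set with minimum `zero` and an order-reversing
involution `star` such that `h ≤ star h` implies `h = zero`. -/
structure PocSet (H : Type u) [PartialOrder H] : Type u where
  star : H → H
  zero : H
  zero_le : ∀ h : H, zero ≤ h
  star_star : ∀ h : H, star (star h) = h
  star_antitone : ∀ a b : H, a ≤ b → star b ≤ star a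
  eq_zero_of_le_star : ∀ h : H, h ≤ star h → h = zero

namespace PocSet

variable {H : Type u} [PartialOrder H]

/-- An element is proper if it is neither `0` nor `0*`. -/
def Proper (P : PocSet H) (h : H) : Prop := h ≠ P.zero ∧ h ≠ P.star P.zero

/-- A poc-set is discrete if every interval between proper elements is finite. -/
def IsDiscrete (P : PocSet H) : Prop :=
  ∀ a b : H, P.Proper a → P.Proper b → (Set.Icc a b).Finite

/-- Two elements are transverse if none of the four nesting relations holds. -/
def Transverse (P : PocSet H) (a b : H) : Prop :=
  ¬ a ≤ b ∧ ¬ P.star a ≤ b ∧ ¬ a ≤ P.star b ∧ ¬ P.star a ≤ P.star b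

/-- ω-dimensionality: no infinite subset of pairwise transverse elements. -/
def OmegaDimensional (P : PocSet H) : Prop :=
  ∀ S : Set H, S.Pairwise P.Transverse → S.Finite

/-- Ultrafilter on a poc-set: (UF1) exactly one of `h`, `h*` belongs;
(UF2) no `h ≤ k*` for members `h, k`. -/
def IsUltra (P : PocSet H) (α : Set H) : Prop :=
  (∀ h : H, h ∈ α ↔ P.star h ∉ α) ∧ ∀ h ∈ α, ∀ k ∈ α, ¬ h ≤ P.star k

/-- An infinite strictly descending chain of elements of `ξ`. -/
def DescChainIn (ξ : Set H) (c : ℕ → H) : Prop :=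
  (∀ n, c n ∈ ξ) ∧ ∀ n, c (n + 1) < c n

/-- Principal ultrafilter: an ultrafilter with no infinite strictly descending chain. -/
def IsPrincipal (P : PocSet H) (α : Set H) : Prop :=
  P.IsUltra α ∧ ¬ ∃ c : ℕ → H, DescChainIn α c

/-- The set of minimal elements of `α`. -/
def minset (α : Set H) : Set H := {a ∈ α | ∀ b ∈ α, b ≤ a → b = a}

/-- Almost equality: both differences are finite. -/
def AlmostEq (α β : Set H) : Prop := (α \ β).Finite ∧ (β \ α).Finite

/-- `Sg` is an almost-equality class of ultrafilters on `P`. -/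
def IsAEClass (P : PocSet H) (Sg : Set (Set H)) : Prop :=
  ∃ α : Set H, P.IsUltra α ∧ Sg = {β | P.IsUltra β ∧ AlmostEq α β}

-- The Tychonoff topology on subsets of `H`, induced from the product topology
-- on `H → Bool` (with `Bool` discrete) via characteristic functions.
open Classical in
noncomputable def tychonoff (H : Type u) : TopologicalSpace (Set H) :=
  TopologicalSpace.induced (fun (α : Set H) (h : H) => decide (h ∈ α)) inferInstance

/-- The median of three subsets of `H`. -/
def med (α β γ : Set H) : Set H := (α ∩ β) ∪ (β ∩ γ) ∪ (α ∩ γ)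

end PocSet

open PocSet

namespace PocSet

variable {H : Type u} [PartialOrder H] {P : PocSet H}

theorem le_star_zero (P : PocSet H) (h : H) : h ≤ P.star P.zero := by
  have := P.star_antitone _ _ (P.zero_le (P.star h))
  rwa [P.star_star] at this

theorem Proper.not_star_le {a : H} (ha : P.Proper a) : ¬ P.star a ≤ a := by
  intro h
  have h₀ : P.star a = P.zero := P.eq_zero_of_le_star _ (by rwa [P.star_star])
  exact ha.2 (by rw [← h₀, P.star_star])

theorem Proper.not_star_le_of_le {a b c : H} (ha : P.Proper a) (hb : b ≤ a) (hc : c ≤ a) :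
    ¬ P.star b ≤ c := fun h =>
  ha.not_star_le ((P.star_antitone _ _ hb).trans (h.trans hc))

theorem IsUltra.mem_of_le {α : Set H} (hα : P.IsUltra α) {h k : H} (hh : h ∈ α) (hk : h ≤ k) :
    k ∈ α := by
  rw [hα.1 k]
  intro hs
  exact hα.2 h hh _ hs (by rwa [P.star_star])

theorem IsUltra.star_mem_iff {α : Set H} (hα : P.IsUltra α) (h : H) :
    P.star h ∈ α ↔ h ∉ α := by
  rw [hα.1 (P.star h), P.star_star]

theorem IsUltra.proper_of_lt {α : Set H} (hα : P.IsUltra α) {a b : H} (hb : b ∈ α)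
    (hba : b < a) : P.Proper b := by
  refine ⟨?_, ?_⟩
  · rintro rfl
    exact hα.2 _ hb _ hb (P.zero_le _)
  · rintro rfl
    exact hba.not_ge (P.le_star_zero a)

/-- Replacing every member of an ultrafilter below a proper element by its complement yields
an ultrafilter. -/
theorem IsUltra.flip {α : Set H} (hα : P.IsUltra α) {a : H} (ha : P.Proper a) :
    P.IsUltra {h | (h ∈ α ∧ ¬ h ≤ a) ∨ (P.star h ∈ α ∧ P.star h ≤ a)} := by
  refine ⟨fun h => ?_, fun h hh k hk hle => ?_⟩
  · simp only [Set.mem_ofPred_eq, P.star_star]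
    have h₁ := hα.star_mem_iff h
    tauto
  · rcases hh with ⟨h₁, h₂⟩ | ⟨h₁, h₂⟩ <;> rcases hk with ⟨k₁, k₂⟩ | ⟨k₁, k₂⟩
    · exact hα.2 h h₁ k k₁ hle
    · exact h₂ (hle.trans k₂)
    · have := P.star_antitone _ _ hle
      rw [P.star_star] at this
      exact k₂ (this.trans h₂)
    · refine ha.not_star_le_of_le h₂ k₂ ?_
      rwa [P.star_star]

/-- If an ultrafilter has finitely many members below a proper member `a`, then some almost
equal ultrafilter does not contain `a`. -/
theorem IsUltra.exists_almostEq_notMem {α : Set H} (hα : P.IsUltra α) {a : H}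
    (ha : P.Proper a) (hfin : {h ∈ α | h ≤ a}.Finite) :
    ∃ β, P.IsUltra β ∧ AlmostEq α β ∧ a ∉ β := by
  refine ⟨_, hα.flip ha, ⟨hfin.subset ?_, (hfin.image P.star).subset ?_⟩, ?_⟩
  · rintro h ⟨h₁, h₂⟩
    exact ⟨h₁, by_contra fun h₃ => h₂ (Or.inl ⟨h₁, h₃⟩)⟩
  · rintro h ⟨h₁ | h₁, h₂⟩
    · exact absurd h₁.1 h₂
    · exact ⟨P.star h, h₁, P.star_star h⟩
  · rintro (⟨-, h⟩ | ⟨-, h⟩)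
    · exact h le_rfl
    · exact ha.not_star_le h

/-- The maximal members of an ultrafilter strictly below a proper element are pairwise
transverse. -/
theorem IsUltra.pairwise_transverse_maximal {α : Set H} (hα : P.IsUltra α) {a : H}
    (ha : P.Proper a) :
    {m | Maximal (fun h => h ∈ α ∧ h < a) m}.Pairwise P.Transverse := by
  intro m hm n hn hne
  rw [Set.mem_ofPred_eq] at hm hn
  refine ⟨fun h => hne (hm.eq_of_le hn.prop h),
    ha.not_star_le_of_le hm.prop.2.le hn.prop.2.le,
    hα.2 _ hm.prop.1 _ hn.prop.1, fun h => hne (hn.eq_of_le hm.prop ?_).symm⟩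
  have := P.star_antitone _ _ h
  rwa [P.star_star, P.star_star] at this

theorem IsUltra.exists_maximal_ge {α : Set H} (hα : P.IsUltra α) (hdisc : P.IsDiscrete) {a b : H}
    (ha : P.Proper a) (hb : b ∈ α) (hba : b < a) :
    ∃ m, b ≤ m ∧ Maximal (fun h => h ∈ α ∧ h < a) m := by
  have hfin : {h | b ≤ h ∧ h < a}.Finite :=
    (hdisc b a (hα.proper_of_lt hb hba) ha).subset fun h hh => ⟨hh.1, hh.2.le⟩
  obtain ⟨m, hm⟩ := hfin.exists_maximal ⟨b, le_rfl, hba⟩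
  refine ⟨m, hm.prop.1, ⟨hα.mem_of_le hb hm.prop.1, hm.prop.2⟩, fun n hn hmn => ?_⟩
  exact hm.le_of_ge ⟨hm.prop.1.trans hmn, hn.2⟩ hmn

end PocSet

theorem stmt12 {H : Type u} [PartialOrder H] (P : PocSet H)
    (hdisc : P.IsDiscrete) (homega : P.OmegaDimensional)
    (Sg : Set (Set H)) (hSg : IsAEClass P Sg)
    (a : H) (ha : P.Proper a) (hall : ∀ α ∈ Sg, a ∈ α) :
    ∃ b : H, P.Proper b ∧ b < a ∧ ∀ α ∈ Sg, b ∈ α := by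
  obtain ⟨α, hα, rfl⟩ := hSg
  by_contra! hno
  have hdown : ∀ b ∈ α, b < a → {h ∈ α | h ≤ b}.Finite := by
    intro b hb hba
    obtain ⟨β, ⟨hβ, hαβ⟩, hbβ⟩ := hno b (hα.proper_of_lt hb hba) hba
    exact hαβ.1.subset fun h hh => ⟨hh.1, fun hhβ => hbβ (hβ.mem_of_le hhβ hh.2)⟩
  have hfin : {h ∈ α | h ≤ a}.Finite := by
    have hbelow : ∀ m ∈ {m | Maximal (fun h => h ∈ α ∧ h < a) m}, {h ∈ α | h ≤ m}.Finite := by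
      intro m hm
      rw [Set.mem_ofPred_eq] at hm
      exact hdown m hm.prop.1 hm.prop.2
    refine (((homega _ (hα.pairwise_transverse_maximal ha)).biUnion hbelow).insert a).subset ?_
    rintro h ⟨hh, hle⟩
    rcases hle.eq_or_lt with rfl | hlt
    · exact Set.mem_insert _ _
    · obtain ⟨m, hhm, hm⟩ := hα.exists_maximal_ge hdisc ha hh hlt
      exact Set.mem_insert_of_mem _ (Set.mem_biUnion hm ⟨hh, hhm⟩)
  obtain ⟨β, hβ, hαβ, haβ⟩ := hα.exists_almostEq_notMem ha hfin
  exact haβ (hall β ⟨hβ, hαβ⟩)
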